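/- arXiv:2304.07118 — 3 statements merged into one kernel-verified Lean document; each statement's English description precedes it below -/
import Mathlib

section
/- Let N ≥ 1 and n ≥ 1 be natural numbers, and let Φ be a ℂ-multilinear map from n copies of Matrix (Fin N) (Fin N) ℂ to ℂ that is Ad-invariant, i.e. Φ (g * X 1 * g⁻¹, …, g * X n * g⁻¹) = Φ (X 1, …, X n) for every invertible g ∈ Matrix (Fin N) (Fin N) ℂ and all X. Then there exist coefficients c : Equiv.Perm (Fin n) → ℂ such that for all X 1, …, X n: Φ (X 1, …, X n) = Σ_{σ : Equiv.Perm (Fin n)} c σ · Σ_{i : Fin n → Fin N} ∏_{k : Fin n} (X k) (i k) (i (σ k)). (For each permutation σ the inner sum equals the product, over the cycles of σ, of the trace of the product of the arguments along the cycle, so this expresses every Ad-invariant n-form on gl(N,ℂ) as a linear combination of products of traces.) -/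
open MvPolynomial in
theorem aux_sym {N n : ℕ} (l S : (Fin n → Fin N × Fin N) → ℂ)
    (hl : ∀ g : Matrix.GeneralLinearGroup (Fin N) ℂ,
      ∑ w, l w * ∏ k, (g : Matrix (Fin N) (Fin N) ℂ) (w k).1 (w k).2 = 0)
    (hS : ∀ (σ : Equiv.Perm (Fin n)) w, S (w ∘ σ) = S w) :
    ∑ w, l w * S w = 0 := by
  classical
  let m : (Fin n → Fin N × Fin N) → (Fin N × Fin N →₀ ℕ) :=
    fun w => ∑ k, Finsupp.single (w k) 1
  have hP : (∑ w, monomial (m w) (l w) : MvPolynomial (Fin N × Fin N) ℂ) = 0 := by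
    apply eq_of_eval_eq_on_gl
    intro g
    rw [map_zero, ← hl g, map_sum]
    refine Finset.sum_congr rfl fun w _ => ?_
    have : (monomial (m w) (l w) : MvPolynomial (Fin N × Fin N) ℂ)
        = C (l w) * ∏ k, X (w k) := by
      have h2 : (∏ k, X (w k) : MvPolynomial (Fin N × Fin N) ℂ) = monomial (m w) 1 := by
        rw [monomial_sum_one]; rfl
      rw [h2, C_mul_monomial, mul_one]
    rw [this]
    simp
  have hcoeff : ∀ d, ∑ w with m w = d, l w = 0 := by
    intro d
    have := congrArg (coeff d) hP
    simpa [coeff_sum, coeff_monomial, Finset.sum_filter] using this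
  have hSm : ∀ w w', m w = m w' → S w = S w' := by
    intro w w' h
    have hc : ∀ (u : Fin n → Fin N × Fin N) j, m u j = Fintype.card {k // u k = j} := by
      intro u j
      simp [m, Finsupp.finsetSum_apply, Finsupp.single_apply, Fintype.card_subtype]
    have e : ∀ j, {k // w k = j} ≃ {k // w' k = j} := fun j =>
      Fintype.equivOfCardEq (by rw [← hc, ← hc, h])
    have : w = w' ∘ (Equiv.ofFiberEquiv e) := by
      funext k
      exact (Equiv.ofFiberEquiv_map e k).symm
    rw [this, hS]
  rw [← Finset.sum_fiberwise_of_maps_to (t := Finset.univ.image m) (g := m)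
    (fun w _ => Finset.mem_image_of_mem _ (Finset.mem_univ w))]
  refine Finset.sum_eq_zero fun d hd => ?_
  obtain ⟨w0, -, rfl⟩ := Finset.mem_image.1 hd
  have : ∑ w with m w = m w0, l w * S w = (∑ w with m w = m w0, l w) * S w0 := by
    rw [Finset.sum_mul]
    refine Finset.sum_congr rfl fun w hw => ?_
    rw [hSm w w0 (Finset.mem_filter.1 hw).2]
  rw [this, hcoeff, zero_mul]

/-- The place-permutation representation. -/
noncomputable def permRep (N n : ℕ) :
    Representation ℂ (Equiv.Perm (Fin n)) ((Fin n → Fin N) → ℂ) where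
  toFun σ := LinearMap.funLeft ℂ ℂ (fun i : Fin n → Fin N => i ∘ σ)
  map_one' := by ext; simp [LinearMap.funLeft]
  map_mul' σ τ := by
    refine LinearMap.ext fun f => funext fun i => ?_
    rfl

theorem permRep_apply {N n : ℕ} (σ : Equiv.Perm (Fin n)) (f : (Fin n → Fin N) → ℂ)
    (i : Fin n → Fin N) : permRep N n σ f i = f (i ∘ σ) := rfl

/-- Double commutant for the place-permutation representation. -/
theorem double_comm {N n : ℕ} (T : ((Fin n → Fin N) → ℂ) →ₗ[ℂ] ((Fin n → Fin N) → ℂ))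
    (hT : ∀ e : ((Fin n → Fin N) → ℂ) →ₗ[ℂ] ((Fin n → Fin N) → ℂ),
      (∀ σ v, e (permRep N n σ v) = permRep N n σ (e v)) → ∀ v, T (e v) = e (T v)) :
    ∃ r : Equiv.Perm (Fin n) → ℂ, ∀ b a,
      T (Pi.single b 1) a = ∑ σ, r σ * (if b = a ∘ σ then 1 else 0) := by
  classical
  let ρ := permRep N n
  let q := ρ.asModuleEquiv
  let f : Module.End (Module.End (MonoidAlgebra ℂ (Equiv.Perm (Fin n))) ρ.asModule) ρ.asModule :=
    { toFun := fun v => q.symm (T (q v))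
      map_add' := by intros; simp
      map_smul' := by
        intro e v
        have := hT (q.toLinearMap ∘ₗ (e.restrictScalars ℂ) ∘ₗ q.symm.toLinearMap) (by
          intro σ v
          simp only [LinearMap.comp_apply, LinearEquiv.coe_coe, LinearMap.restrictScalars_apply]
          change q (e (ρ.asModuleEquiv.symm (ρ σ v))) = _
          rw [Representation.asModuleEquiv_symm_map_rho, map_smul]
          change ρ.asModuleEquiv _ = _
          rw [Representation.asModuleEquiv_map_smul]
          simp
          rfl) (q v)
        simp only [LinearMap.comp_apply, LinearEquiv.coe_coe, LinearMap.restrictScalars_apply,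
          LinearEquiv.symm_apply_apply] at this
        simp only [Module.End.smul_def, RingHom.id_apply]
        rw [this, LinearEquiv.symm_apply_apply] }
  obtain ⟨r, hr⟩ := jacobson_density f
    (Finset.univ.image fun b : Fin n → Fin N => q.symm (Pi.single b 1))
  refine ⟨fun σ => r.coeff σ, fun b a => ?_⟩
  have h := hr _ (Finset.mem_image_of_mem _ (Finset.mem_univ b))
  have h2 := congrArg (fun v => q v a) h
  change q (q.symm (T (q (q.symm _)))) a = ρ.asModuleEquiv (r • _) a at h2
  rw [Representation.asModuleEquiv_map_smul, LinearEquiv.apply_symm_apply,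
    LinearEquiv.apply_symm_apply] at h2
  rw [h2]
  change ρ.asAlgebraHom r (q (q.symm _)) a = _
  rw [LinearEquiv.apply_symm_apply, Representation.asAlgebraHom_def, MonoidAlgebra.lift_apply,
    Finsupp.sum_fintype _ _ (by simp)]
  simp only [LinearMap.sum_apply, Finset.sum_apply, LinearMap.smul_apply, Pi.smul_apply,
    smul_eq_mul]
  refine Finset.sum_congr rfl fun σ _ => ?_
  change r.coeff σ * (Pi.single b 1 : (Fin n → Fin N) → ℂ) (a ∘ σ) = _
  rw [Pi.single_apply]
  simp only [eq_comm]

/-- **Trace decomposition theorem for gl(N, ℂ).**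
Every Ad-invariant ℂ-multilinear n-form on N×N complex matrices is a linear
combination, over permutations σ of the arguments, of the contractions
`∑ i, ∏ k, (X k) (i k) (i (σ k))` (products of traces along the cycles of σ). -/
theorem trace_decomposition_gl (N n : ℕ) (hN : 1 ≤ N) (hn : 1 ≤ n)
    (Φ : MultilinearMap ℂ (fun _ : Fin n => Matrix (Fin N) (Fin N) ℂ) ℂ)
    (hinv : ∀ (g : (Matrix (Fin N) (Fin N) ℂ)ˣ) (X : Fin n → Matrix (Fin N) (Fin N) ℂ),
      Φ (fun k => (g : Matrix (Fin N) (Fin N) ℂ) * X k *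
        ((g⁻¹ : (Matrix (Fin N) (Fin N) ℂ)ˣ) : Matrix (Fin N) (Fin N) ℂ)) = Φ X) :
    ∃ c : Equiv.Perm (Fin n) → ℂ,
      ∀ X : Fin n → Matrix (Fin N) (Fin N) ℂ,
        Φ X = ∑ σ : Equiv.Perm (Fin n), c σ *
          ∑ i : Fin n → Fin N, ∏ k : Fin n, X k (i k) (i (σ k)) := by
  classical
  let E : Fin N × Fin N → Matrix (Fin N) (Fin N) ℂ := fun p => Matrix.single p.1 p.2 1
  let F : (Fin n → Fin N) → (Fin n → Fin N) → ℂ := fun a b => Φ fun k => Matrix.single (a k) (b k) 1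
  have hexp : ∀ X, Φ X = ∑ a : Fin n → Fin N, ∑ b : Fin n → Fin N,
      (∏ k, X k (a k) (b k)) * F a b := by
    intro X
    have hX : X = fun k => ∑ p : Fin N × Fin N, X k p.1 p.2 • E p := by
      funext k
      conv_lhs => rw [Matrix.matrix_eq_sum_single (X k)]
      rw [Fintype.sum_prod_type]
      simp [E, Matrix.smul_single]
    conv_lhs => rw [hX]
    rw [MultilinearMap.map_sum]
    simp only [MultilinearMap.map_smul_univ]
    rw [← (Equiv.arrowProdEquivProdArrow (Fin n) (fun _ => Fin N) (fun _ => Fin N)).symm.sum_comp,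
      Fintype.sum_prod_type]
    rfl
  have hcomm : ∀ (g : (Matrix (Fin N) (Fin N) ℂ)ˣ) (a b : Fin n → Fin N),
      ∑ c : Fin n → Fin N, (∏ k, (g : Matrix (Fin N) (Fin N) ℂ) (c k) (a k)) * F c b
      = ∑ c : Fin n → Fin N, (∏ k, (g : Matrix (Fin N) (Fin N) ℂ) (b k) (c k)) * F a c := by
    intro g a b
    have h := hinv g (fun k => Matrix.single (a k) (b k) 1 * (g : Matrix (Fin N) (Fin N) ℂ))
    have h1 : (fun k => (g : Matrix (Fin N) (Fin N) ℂ) *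
        (Matrix.single (a k) (b k) 1 * (g : Matrix (Fin N) (Fin N) ℂ)) *
        ((g⁻¹ : (Matrix (Fin N) (Fin N) ℂ)ˣ) : Matrix (Fin N) (Fin N) ℂ))
        = fun k => ∑ c : Fin N, (g : Matrix (Fin N) (Fin N) ℂ) c (a k) •
          Matrix.single c (b k) (1 : ℂ) := by
      funext k
      rw [mul_assoc, mul_assoc, Units.mul_inv, mul_one]
      ext i j
      simp [Matrix.mul_apply, Matrix.sum_apply, Matrix.single_apply, ite_and, eq_comm]
    have h2 : (fun k => Matrix.single (a k) (b k) 1 * (g : Matrix (Fin N) (Fin N) ℂ))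
        = fun k => ∑ c : Fin N, (g : Matrix (Fin N) (Fin N) ℂ) (b k) c •
          Matrix.single (a k) c (1 : ℂ) := by
      funext k
      ext i j
      simp [Matrix.mul_apply, Matrix.sum_apply, Matrix.single_apply, ite_and, eq_comm]
    rw [h1, h2, MultilinearMap.map_sum, MultilinearMap.map_sum] at h
    simpa only [MultilinearMap.map_smul_univ, smul_eq_mul] using h
  have hS : ∀ S : (Fin n → Fin N) → (Fin n → Fin N) → ℂ,
      (∀ (σ : Equiv.Perm (Fin n)) a b, S (a ∘ σ) (b ∘ σ) = S a b) →
      ∀ a b, ∑ c, S c a * F c b = ∑ c, S b c * F a c := by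
    intro S hS a b
    have hsum : ∀ S : (Fin n → Fin N) → (Fin n → Fin N) → ℂ,
        ∑ w : Fin n → Fin N × Fin N,
          ((if (fun k => (w k).2) = a then F (fun k => (w k).1) b else 0)
          - (if (fun k => (w k).1) = b then F a (fun k => (w k).2) else 0))
          * S (fun k => (w k).1) (fun k => (w k).2)
        = ∑ c, S c a * F c b - ∑ c, S b c * F a c := by
      intro S
      have h1 : ∑ w : Fin n → Fin N × Fin N,
          ((if (fun k => (w k).2) = a then F (fun k => (w k).1) b else 0)
          - (if (fun k => (w k).1) = b then F a (fun k => (w k).2) else 0))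
          * S (fun k => (w k).1) (fun k => (w k).2)
          = ∑ x, ∑ y, ((if y = a then F x b else 0) - (if x = b then F a y else 0)) * S x y := by
        rw [← (Equiv.arrowProdEquivProdArrow (Fin n) (fun _ => Fin N)
          (fun _ => Fin N)).symm.sum_comp, Fintype.sum_prod_type]
        rfl
      rw [h1]
      simp only [sub_mul, Finset.sum_sub_distrib]
      congr 1
      · simp [ite_mul, mul_comm]
      · rw [Finset.sum_comm]
        simp [ite_mul, mul_comm]
    have key := aux_sym (N := N) (n := n)
      (fun w => (if (fun k => (w k).2) = a then F (fun k => (w k).1) b else 0)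
        - (if (fun k => (w k).1) = b then F a (fun k => (w k).2) else 0))
      (fun w => S (fun k => (w k).1) (fun k => (w k).2)) ?_ ?_
    · rw [hsum S] at key
      exact sub_eq_zero.1 key
    · intro g
      have := hsum (fun x y => ∏ k, (g : Matrix (Fin N) (Fin N) ℂ) (x k) (y k))
      rw [this]
      exact sub_eq_zero.2 (hcomm g a b)
    · intro σ w
      exact hS σ (fun k => (w k).1) (fun k => (w k).2)
  let T := Matrix.toLin' (Matrix.of fun b c => F c b)
  obtain ⟨r, hr⟩ := double_comm (N := N) (n := n) T (by
    intro e he v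
    have hm : Matrix.of (fun b c => F c b) * LinearMap.toMatrix' e
        = LinearMap.toMatrix' e * Matrix.of (fun b c => F c b) := by
      ext b a
      rw [Matrix.mul_apply, Matrix.mul_apply]
      have := hS (fun x y => LinearMap.toMatrix' e x y) (by
        intro σ a b
        simp only [LinearMap.toMatrix'_apply]
        have h := congrFun (he σ (Pi.single (b ∘ σ) 1)) a
        rw [permRep_apply] at h
        rw [← h]
        refine congrFun (congrArg e ?_) a
        funext i
        rw [permRep_apply, Pi.single_apply, Pi.single_apply]
        have : i ∘ σ = b ∘ σ ↔ i = b := σ.surjective.injective_comp_right.eq_iff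
        simp [this]) a b
      simpa [mul_comm] using this
    have h := congrArg (fun M => Matrix.toLin' M v) hm
    simpa [Matrix.toLin'_mul, T] using h)
  have hF : ∀ a b, F a b = ∑ σ, r σ * (if a = b ∘ σ then 1 else 0) := by
    intro a b
    rw [← hr]
    simp [T]
  refine ⟨fun σ => r σ⁻¹, fun X => ?_⟩
  rw [hexp]
  have hF' : ∀ a b, F a b = ∑ σ : Equiv.Perm (Fin n), r σ⁻¹ * (if b = a ∘ σ then 1 else 0) := by
    intro a b
    rw [hF, ← Equiv.sum_comp (Equiv.inv (Equiv.Perm (Fin n)))]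
    refine Finset.sum_congr rfl fun σ _ => ?_
    have : a = b ∘ (σ⁻¹ : Equiv.Perm (Fin n)) ↔ b = a ∘ σ := by
      constructor
      · rintro rfl; funext k; simp
      · rintro rfl; funext k; simp
    simp only [Equiv.inv_apply, this]
  simp only [hF', Finset.mul_sum]
  calc _ = ∑ a : Fin n → Fin N, ∑ σ : Equiv.Perm (Fin n), ∑ b : Fin n → Fin N,
        (∏ k, X k (a k) (b k)) * (r σ⁻¹ * (if b = a ∘ σ then 1 else 0)) :=
        Finset.sum_congr rfl fun a _ => Finset.sum_comm
    _ = _ := by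
        rw [Finset.sum_comm]
        refine Finset.sum_congr rfl fun σ _ => Finset.sum_congr rfl fun a _ => ?_
        simp [mul_comm]
end

section
/- Let n ≥ 1 and let Φ : (Fin 4 → ℝ)ⁿ → ℝ be an ℝ-multilinear map such that Φ (Λ.mulVec v 1, …, Λ.mulVec v n) = Φ (v 1, …, v n) for every real 4×4 matrix Λ with Λᵀ * η * Λ = η and det Λ = 1, where η = diag(1,−1,−1,−1). Then Φ lies in the ℝ-linear span of the multilinear forms of the shape (v 1, …, v n) ↦ ∏_{{i,j} ∈ P} ⟨v i, v j⟩_η · ∏_{(i,j,k,l) ∈ Q} det [v i, v j, v k, v l], where ⟨v,w⟩_η := v 0 · w 0 − v 1 · w 1 − v 2 · w 2 − v 3 · w 3, det [v i, v j, v k, v l] denotes the determinant of the 4×4 matrix whose rows are these four vectors, and (P, Q) ranges over all ways of partitioning the index set {1,…,n} into unordered pairs (collected in P) and ordered quadruples (collected in Q). In particular, every multilinear form on ℝ⁴ invariant under the special Lorentz group is built from the Minkowski metric and the Levi-Civita symbol. -/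
noncomputable section

open Matrix

/-- The Minkowski metric diag(1, −1, −1, −1) as a 4×4 real matrix. -/
def ηM : Matrix (Fin 4) (Fin 4) ℝ := Matrix.diagonal ![1, -1, -1, -1]

/-- The Minkowski inner product ⟨v,w⟩_η = v⁰w⁰ − v¹w¹ − v²w² − v³w³. -/
def minkDot (v w : Fin 4 → ℝ) : ℝ := v 0 * w 0 - v 1 * w 1 - v 2 * w 2 - v 3 * w 3

namespace LorentzFFT

/-- The type of multilinear forms with slots indexed by `ι`. -/
abbrev MF (ι : Type) := MultilinearMap ℝ (fun _ : ι => (Fin 4 → ℝ)) ℝ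

/-- Invariance under the special Lorentz group. -/
def InvF {ι : Type} (Φ : MF ι) : Prop :=
  ∀ L : Matrix (Fin 4) (Fin 4) ℝ, Lᵀ * ηM * L = ηM → L.det = 1 →
      ∀ v : ι → (Fin 4 → ℝ), Φ (fun k => L.mulVec (v k)) = Φ v

/-- The standard forms. -/
def goodSet (ι : Type) : Set (MF ι) :=
  { F : MF ι |
        ∃ (a b : ℕ) (e : (Fin a × Fin 2) ⊕ (Fin b × Fin 4) ≃ ι),
          ∀ v : ι → (Fin 4 → ℝ),
            F v = (∏ i : Fin a, minkDot (v (e (Sum.inl (i, 0)))) (v (e (Sum.inl (i, 1)))))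
              * ∏ j : Fin b,
                  Matrix.det (Matrix.of fun p q : Fin 4 => v (e (Sum.inr (j, p))) q) }

/-- The span of the standard forms. -/
def W (ι : Type) : Submodule ℝ (MF ι) := Submodule.span ℝ (goodSet ι)

/-- standard basis vector -/
def eb (a : Fin 4) : Fin 4 → ℝ := Pi.single a 1

/-- signs of the metric -/
def sg (a : Fin 4) : ℝ := (![1, -1, -1, -1] : Fin 4 → ℝ) a

lemma eb_expand (w : Fin 4 → ℝ) : w = ∑ a, w a • eb a := by
  funext q
  simp [eb, Finset.sum_apply, Pi.single_apply]

lemma mf_continuous {ι : Type} [Fintype ι] (Φ : MF ι) : Continuous Φ := by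
  classical
  have h : (Φ : (ι → (Fin 4 → ℝ)) → ℝ) = fun v => ∑ f : ι → Fin 4, (∏ k, v k (f k)) *
      Φ (fun k => eb (f k)) := by
    funext v
    conv_lhs => rw [show v = fun k => ∑ a, v k a • eb a from funext fun k => eb_expand (v k)]
    rw [MultilinearMap.map_sum]
    refine Finset.sum_congr rfl fun f _ => ?_
    rw [MultilinearMap.map_smul_univ, smul_eq_mul]
  rw [h]
  fun_prop

lemma etaM_sq : ηM * ηM = 1 := by
  ext i j
  fin_cases i <;> fin_cases j <;> simp [ηM]

lemma exp_lorentz (X : Matrix (Fin 4) (Fin 4) ℝ) (hX : Xᵀ * ηM + ηM * X = 0) :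
    (NormedSpace.exp X)ᵀ * ηM * (NormedSpace.exp X) = ηM := by
  have hu : IsUnit ηM := IsUnit.of_mul_eq_one _ etaM_sq
  have hinv : ηM⁻¹ = ηM := Matrix.inv_eq_right_inv etaM_sq
  have h1 : Xᵀ = ηM * (-X) * ηM⁻¹ := by
    have : Xᵀ * ηM = ηM * (-X) := by
      rw [Matrix.mul_neg]; exact eq_neg_of_add_eq_zero_left hX
    rw [← this, hinv, Matrix.mul_assoc, etaM_sq, Matrix.mul_one]
  rw [← Matrix.exp_transpose, h1, Matrix.exp_conj _ _ hu, hinv, Matrix.mul_assoc _ ηM ηM, etaM_sq,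
    Matrix.mul_one, Matrix.mul_assoc, ← Matrix.exp_add_of_commute _ _ (Commute.neg_left (Commute.refl X))]
  simp

lemma exp_det (X : Matrix (Fin 4) (Fin 4) ℝ) (hX : Xᵀ * ηM + ηM * X = 0) :
    (NormedSpace.exp X).det = 1 := by
  have h2 : X = (2:ℕ) • ((1/2:ℝ) • X) := by
    rw [← Nat.cast_smul_eq_nsmul ℝ, smul_smul]; norm_num
  have h3 : ((1/2:ℝ) • X)ᵀ * ηM + ηM * ((1/2:ℝ) • X) = 0 := by
    rw [Matrix.transpose_smul, Matrix.smul_mul, Matrix.mul_smul, ← smul_add, hX, smul_zero]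
  have h4 := congrArg Matrix.det (exp_lorentz _ h3)
  have h5 : ηM.det ≠ 0 := by simp [ηM, Matrix.det_diagonal, Fin.prod_univ_four]
  rw [h2, Matrix.exp_nsmul, Matrix.det_pow]
  rw [Matrix.det_mul, Matrix.det_mul, Matrix.det_transpose] at h4
  apply mul_left_cancel₀ h5
  linear_combination h4

open scoped Matrix.Norms.Operator in
lemma exp_mulVec_deriv (X : Matrix (Fin 4) (Fin 4) ℝ) (v : Fin 4 → ℝ) :
    HasDerivAt (fun t : ℝ => (NormedSpace.exp (t • X)).mulVec v) (X.mulVec v) 0 := by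
  have h := hasDerivAt_exp_smul_const (𝕂 := ℝ) X (0:ℝ)
  rw [zero_smul, NormedSpace.exp_zero, one_mul] at h
  let ℓ : Matrix (Fin 4) (Fin 4) ℝ →ₗ[ℝ] (Fin 4 → ℝ) :=
    { toFun := fun M => M.mulVec v
      map_add' := fun A B => Matrix.add_mulVec A B v
      map_smul' := fun c A => Matrix.smul_mulVec c A v }
  exact (LinearMap.toContinuousLinearMap ℓ).hasFDerivAt.comp_hasDerivAt (0:ℝ) h

lemma infinitesimal {ι : Type} [Fintype ι] [DecidableEq ι] (Φ : MF ι) (hΦ : InvF Φ)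
    (X : Matrix (Fin 4) (Fin 4) ℝ) (hX : Xᵀ * ηM + ηM * X = 0) (v : ι → (Fin 4 → ℝ)) :
    ∑ k, Φ (Function.update v k (X.mulVec (v k))) = 0 := by
  let F : ContinuousMultilinearMap ℝ (fun _ : ι => (Fin 4 → ℝ)) ℝ := ⟨Φ, mf_continuous Φ⟩
  have hd : HasDerivAt (fun t : ℝ => fun k => (NormedSpace.exp (t • X)).mulVec (v k))
      (fun k => X.mulVec (v k)) 0 := hasDerivAt_pi.2 fun k => exp_mulVec_deriv X (v k)
  have h0 : (fun k => (NormedSpace.exp ((0:ℝ) • X)).mulVec (v k)) = v := by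
    funext k; simp
  have hF : HasFDerivAt F (F.linearDeriv v)
      (fun k => (NormedSpace.exp ((0:ℝ) • X)).mulVec (v k)) := by
    rw [h0]; exact F.hasFDerivAt v
  have hc := hF.comp_hasDerivAt (0:ℝ) hd
  have hconst : (F ∘ fun t : ℝ => fun k => (NormedSpace.exp (t • X)).mulVec (v k))
      = fun _ => Φ v := by
    funext t
    have hs : (t • X)ᵀ * ηM + ηM * (t • X) = 0 := by
      rw [Matrix.transpose_smul, Matrix.smul_mul, Matrix.mul_smul, ← smul_add, hX, smul_zero]
    exact hΦ _ (exp_lorentz _ hs) (exp_det _ hs) v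
  rw [hconst] at hc
  have := hc.unique (hasDerivAt_const (0:ℝ) (Φ v))
  rw [ContinuousMultilinearMap.linearDeriv_apply] at this
  exact this

/-- The infinitesimal Lorentz transformation attached to two vectors. -/
def xmat (u w : Fin 4 → ℝ) : Matrix (Fin 4) (Fin 4) ℝ :=
  Matrix.vecMulVec w (ηM.mulVec u) - Matrix.vecMulVec u (ηM.mulVec w)

lemma xmat_skew (u w : Fin 4 → ℝ) : (xmat u w)ᵀ * ηM + ηM * xmat u w = 0 := by
  ext p q
  fin_cases p <;> fin_cases q <;>
    simp [xmat, ηM, Matrix.vecMulVec_apply, Matrix.mulVec_diagonal]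

lemma xmat_mulVec (u w v : Fin 4 → ℝ) :
    (xmat u w).mulVec v = minkDot u v • w - minkDot w v • u := by
  funext p
  fin_cases p <;>
    simp [xmat, ηM, Matrix.vecMulVec_apply, minkDot, Matrix.mulVec,
      dotProduct, Fin.sum_univ_four] <;> ring

lemma minkDot_eb_left (a : Fin 4) (v : Fin 4 → ℝ) : minkDot (eb a) v = sg a * v a := by
  fin_cases a <;> simp [minkDot, eb, sg]

lemma minkDot_eb_right (a : Fin 4) (v : Fin 4 → ℝ) : minkDot v (eb a) = sg a * v a := by
  fin_cases a <;> simp [minkDot, eb, sg]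

lemma sg_sq (a : Fin 4) : sg a * sg a = 1 := by
  fin_cases a <;> simp [sg]

lemma minkDot_eb_self (a : Fin 4) : minkDot (eb a) (eb a) = sg a := by
  rw [minkDot_eb_left]; simp [eb]

lemma update_expand {ι : Type} [DecidableEq ι] (Φ : MF ι) (v : ι → (Fin 4 → ℝ)) (i : ι)
    (w : Fin 4 → ℝ) :
    Φ (Function.update v i w) = ∑ a, w a * Φ (Function.update v i (eb a)) := by
  conv_lhs => rw [eb_expand w]
  rw [MultilinearMap.map_update_sum]
  refine Finset.sum_congr rfl fun a _ => ?_
  rw [MultilinearMap.map_update_smul, smul_eq_mul]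

lemma casimir {ι : Type} [Fintype ι] [DecidableEq ι] (Φ : MF ι) (hΦ : InvF Φ) (i : ι)
    (v : ι → (Fin 4 → ℝ)) :
    3 * Φ v + ∑ k ∈ Finset.univ.erase i, Φ (fun x => v (Equiv.swap i k x)) =
      ∑ k ∈ Finset.univ.erase i, minkDot (v i) (v k) *
        ∑ a, sg a * Φ (Function.update (Function.update v i (eb a)) k (eb a)) := by
  have h1 : ∀ a : Fin 4,
      Φ (Function.update v i (sg a • v i - (sg a * v i a) • eb a)) +
      ∑ k ∈ Finset.univ.erase i, (sg a * v k a *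
        Φ (Function.update (Function.update v k (v i)) i (eb a)) - minkDot (v i) (v k) *
         Φ (Function.update (Function.update v i (eb a)) k (eb a))) = 0 := by
    intro a
    have h := infinitesimal Φ hΦ (xmat (eb a) (v i)) (xmat_skew _ _) (Function.update v i (eb a))
    rw [← Finset.add_sum_erase _ _ (Finset.mem_univ i)] at h
    rw [← h]
    congr 1
    · rw [Function.update_idem, Function.update_self, xmat_mulVec, minkDot_eb_self,
        minkDot_eb_right]
    · refine Finset.sum_congr rfl fun k hk => ?_
      have hki : k ≠ i := Finset.ne_of_mem_erase hk
      rw [Function.update_of_ne hki, xmat_mulVec, MultilinearMap.map_update_sub,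
        MultilinearMap.map_update_smul, MultilinearMap.map_update_smul, minkDot_eb_left,
        Function.update_comm hki]
      simp only [smul_eq_mul]
  have h2 : ∑ a, sg a * Φ (Function.update v i (sg a • v i - (sg a * v i a) • eb a)) = 3 * Φ v := by
    have : ∀ a, sg a * Φ (Function.update v i (sg a • v i - (sg a * v i a) • eb a)) =
        Φ v - v i a * Φ (Function.update v i (eb a)) := by
      intro a
      rw [MultilinearMap.map_update_sub, MultilinearMap.map_update_smul,
        MultilinearMap.map_update_smul, Function.update_eq_self]
      simp only [smul_eq_mul]
      linear_combination (Φ v - v i a * Φ (Function.update v i (eb a))) * sg_sq a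
    rw [Finset.sum_congr rfl fun a _ => this a, Finset.sum_sub_distrib, ← update_expand,
      Function.update_eq_self]
    simp
    ring
  have h3 : ∀ k ∈ Finset.univ.erase i, Φ (fun x => v (Equiv.swap i k x)) =
      ∑ a, v k a * Φ (Function.update (Function.update v k (v i)) i (eb a)) := by
    intro k hk
    have hki : k ≠ i := Finset.ne_of_mem_erase hk
    rw [← update_expand]
    congr 1
    funext x
    by_cases hx : x = i
    · subst hx; simp
    · by_cases hx' : x = k
      · subst hx'; simp [hx]
      · simp [hx, hx', Equiv.swap_apply_of_ne_of_ne]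
  have h4 : ∑ a, sg a * (Φ (Function.update v i (sg a • v i - (sg a * v i a) • eb a)) +
      ∑ k ∈ Finset.univ.erase i, (sg a * v k a *
        Φ (Function.update (Function.update v k (v i)) i (eb a)) - minkDot (v i) (v k) *
         Φ (Function.update (Function.update v i (eb a)) k (eb a)))) = 0 :=
    Finset.sum_eq_zero fun a _ => by rw [h1 a, mul_zero]
  simp only [mul_add, Finset.sum_add_distrib, h2, Finset.mul_sum] at h4
  rw [Finset.sum_comm, ← sub_eq_zero.2 (rfl : (0:ℝ) = 0)] at h4
  rw [Finset.sum_congr rfl h3, ← sub_eq_zero, add_sub_assoc, ← Finset.sum_sub_distrib]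
  rw [sub_zero] at h4
  rw [← h4]
  congr 1
  refine Finset.sum_congr rfl fun k _ => ?_
  rw [Finset.mul_sum, ← Finset.sum_sub_distrib]
  refine Finset.sum_congr rfl fun a _ => ?_
  linear_combination (-v k a * Φ (Function.update (Function.update v k (v i)) i (eb a))) * sg_sq a

/-- The remaining slots after removing two of them. -/
abbrev Rest {ι : Type} (i k : ι) := {x : ι // x ≠ i ∧ x ≠ k}

/-- Multiplying a form in the remaining slots by the metric in slots `i`, `k`. -/
def mulLift {ι : Type} (i k : ι) (hik : i ≠ k) : MF (Rest i k) →ₗ[ℝ] MF ι where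
  toFun Ψ :=
    { toFun := fun v => minkDot (v i) (v k) * Ψ (fun x => v x.1)
      map_update_add' := by
        intro _ m x p q
        by_cases hi : x = i
        · subst hi
          have h : ∀ p : Fin 4 → ℝ, (fun y : Rest x k => Function.update m x p y.1)
              = fun y => m y.1 := fun p => funext fun y => Function.update_of_ne y.2.1 _ _
          simp only [h, Function.update_self, Function.update_of_ne hik.symm]
          simp only [minkDot, Pi.add_apply]; ring
        · by_cases hk : x = k
          · subst hk
            have h : ∀ p : Fin 4 → ℝ, (fun y : Rest i x => Function.update m x p y.1)
                = fun y => m y.1 := fun p => funext fun y => Function.update_of_ne y.2.2 _ _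
            simp only [h, Function.update_self, Function.update_of_ne hik]
            simp only [minkDot, Pi.add_apply]; ring
          · classical
            have h : ∀ p : Fin 4 → ℝ, (fun y : Rest i k => Function.update m x p y.1)
                = Function.update (fun y : Rest i k => m y.1) ⟨x, hi, hk⟩ p := by
              intro p; funext y
              by_cases hy : y = ⟨x, hi, hk⟩
              · subst hy; simp
              · have : y.1 ≠ x := fun h => hy (Subtype.ext h)
                rw [Function.update_of_ne this, Function.update_of_ne hy]
            simp only [h, Function.update_of_ne (Ne.symm hi), Function.update_of_ne (Ne.symm hk),
              MultilinearMap.map_update_add]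
            ring
      map_update_smul' := by
        intro _ m x c p
        by_cases hi : x = i
        · subst hi
          have h : ∀ p : Fin 4 → ℝ, (fun y : Rest x k => Function.update m x p y.1)
              = fun y => m y.1 := fun p => funext fun y => Function.update_of_ne y.2.1 _ _
          simp only [h, Function.update_self, Function.update_of_ne hik.symm]
          simp only [minkDot, Pi.smul_apply, smul_eq_mul]; ring
        · by_cases hk : x = k
          · subst hk
            have h : ∀ p : Fin 4 → ℝ, (fun y : Rest i x => Function.update m x p y.1)
                = fun y => m y.1 := fun p => funext fun y => Function.update_of_ne y.2.2 _ _
            simp only [h, Function.update_self, Function.update_of_ne hik]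
            simp only [minkDot, Pi.smul_apply, smul_eq_mul]; ring
          · classical
            have h : ∀ p : Fin 4 → ℝ, (fun y : Rest i k => Function.update m x p y.1)
                = Function.update (fun y : Rest i k => m y.1) ⟨x, hi, hk⟩ p := by
              intro p; funext y
              by_cases hy : y = ⟨x, hi, hk⟩
              · subst hy; simp
              · have : y.1 ≠ x := fun h => hy (Subtype.ext h)
                rw [Function.update_of_ne this, Function.update_of_ne hy]
            simp only [h, Function.update_of_ne (Ne.symm hi), Function.update_of_ne (Ne.symm hk),
              MultilinearMap.map_update_smul, smul_eq_mul]
            ring }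
  map_add' A B := by ext v; simp [mul_add]
  map_smul' c A := by ext v; simp; ring

lemma mulLift_apply {ι : Type} (i k : ι) (hik : i ≠ k) (Ψ : MF (Rest i k))
    (v : ι → (Fin 4 → ℝ)) :
    mulLift i k hik Ψ v = minkDot (v i) (v k) * Ψ (fun x => v x.1) := rfl

/-- Extending an indexing of the remaining slots by one further pair. -/
def extFun {ι : Type} (i k : ι) {a b : ℕ}
    (e : (Fin a × Fin 2) ⊕ (Fin b × Fin 4) ≃ Rest i k) :
    (Fin (a + 1) × Fin 2) ⊕ (Fin b × Fin 4) → ι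
  | Sum.inl (p, q) => Fin.cases (if q = 0 then i else k) (fun p' => (e (Sum.inl (p', q))).1) p
  | Sum.inr x => (e (Sum.inr x)).1

lemma extFun_bij {ι : Type} (i k : ι) (hik : i ≠ k) {a b : ℕ}
    (e : (Fin a × Fin 2) ⊕ (Fin b × Fin 4) ≃ Rest i k) :
    Function.Bijective (extFun i k e) := by
  constructor
  · rintro (⟨p, q⟩ | x) (⟨p', q'⟩ | x') h
    · refine Fin.cases ?_ (fun p => ?_) p h <;> refine Fin.cases ?_ (fun p' => ?_) p' <;> intro h
      · fin_cases q <;> fin_cases q' <;> simp [extFun, hik, hik.symm] at h ⊢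
      · have := (e (Sum.inl (p', q'))).2
        fin_cases q <;> simp [extFun] at h <;> rw [← h] at this <;> simp at this
      · have := (e (Sum.inl (p, q))).2
        fin_cases q' <;> simp [extFun] at h <;> rw [h] at this <;> simp at this
      · have := e.injective (Subtype.ext (show (e (Sum.inl (p, q))).1 = _ from h))
        simp only [Sum.inl.injEq, Prod.mk.injEq] at this
        rw [this.1, this.2]
    · refine Fin.cases ?_ (fun p => ?_) p h <;> intro h
      · have := (e (Sum.inr x')).2
        fin_cases q <;> simp [extFun] at h <;> rw [← h] at this <;> simp at this
      · have := e.injective (Subtype.ext (show (e (Sum.inl (p, q))).1 = _ from h))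
        simp at this
    · refine Fin.cases ?_ (fun p' => ?_) p' h <;> intro h
      · have := (e (Sum.inr x)).2
        fin_cases q' <;> simp [extFun] at h <;> rw [h] at this <;> simp at this
      · have := e.injective (Subtype.ext (show (e (Sum.inr x)).1 = _ from h))
        simp at this
    · have := e.injective (Subtype.ext (show (e (Sum.inr x)).1 = _ from h))
      exact congrArg Sum.inr (Sum.inr.inj this)
  · intro y
    by_cases hi : y = i
    · exact ⟨Sum.inl (0, 0), by simp [extFun, hi]⟩
    · by_cases hk : y = k
      · exact ⟨Sum.inl (0, 1), by simp [extFun, hk]⟩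
      · obtain ⟨x, hx⟩ := e.surjective ⟨y, hi, hk⟩
        rcases x with ⟨p, q⟩ | x
        · exact ⟨Sum.inl (p.succ, q), by simp [extFun, hx]⟩
        · exact ⟨Sum.inr x, by simp [extFun, hx]⟩

lemma mulLift_mem {ι : Type} (i k : ι) (hik : i ≠ k) (Ψ : MF (Rest i k))
    (h : Ψ ∈ W (Rest i k)) : mulLift i k hik Ψ ∈ W ι := by
  have : W (Rest i k) ≤ (W ι).comap (mulLift i k hik) := by
    refine Submodule.span_le.2 ?_
    rintro F ⟨a, b, e, hF⟩
    refine Submodule.subset_span ⟨a + 1, b, Equiv.ofBijective _ (extFun_bij i k hik e), ?_⟩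
    intro v
    rw [mulLift_apply, hF, Fin.prod_univ_succ, ← mul_assoc]
    rfl
  exact this h

/-- Contraction of two slots with the metric. -/
def contr {ι : Type} [DecidableEq ι] (i k : ι) (Φ : MF ι) : MF (Rest i k) :=
  ∑ a, sg a • Φ.domDomRestrict (fun x => x ≠ i ∧ x ≠ k) (fun _ => eb a)

/-- Fill the two removed slots with two given vectors. -/
def fill {ι : Type} [DecidableEq ι] (i k : ι) (v : Rest i k → (Fin 4 → ℝ)) (w w' : Fin 4 → ℝ) :
    ι → (Fin 4 → ℝ) :=
  Function.update (Function.update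
    (fun x => if h : x ≠ i ∧ x ≠ k then v ⟨x, h⟩ else 0) i w) k w'

lemma contr_apply {ι : Type} [DecidableEq ι] (i k : ι) (Φ : MF ι) (v : Rest i k → (Fin 4 → ℝ)) :
    contr i k Φ v = ∑ a, sg a * Φ (fill i k v (eb a) (eb a)) := by
  simp only [contr, _root_.sum_apply, _root_.smul_apply, smul_eq_mul]
  refine Finset.sum_congr rfl fun a _ => ?_
  congr 1
  rw [MultilinearMap.domDomRestrict_apply]
  congr 1
  funext x
  by_cases hk : x = k
  · subst hk; simp [fill]
  · by_cases hi : x = i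
    · subst hi; simp [fill, hk]
    · simp [fill, hi, hk]

lemma contr_restrict {ι : Type} [DecidableEq ι] (i k : ι) (Φ : MF ι)
    (v : ι → (Fin 4 → ℝ)) :
    contr i k Φ (fun x => v x.1) =
      ∑ a, sg a * Φ (Function.update (Function.update v i (eb a)) k (eb a)) := by
  rw [contr_apply]
  refine Finset.sum_congr rfl fun a _ => ?_
  congr 2
  funext x
  by_cases hk : x = k
  · subst hk; simp [fill]
  · by_cases hi : x = i
    · subst hi; simp [fill, hk]
    · simp [fill, hi, hk]

lemma fill_expand {ι : Type} [DecidableEq ι] (i k : ι) (hik : i ≠ k) (Φ : MF ι)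
    (v : Rest i k → (Fin 4 → ℝ)) (w w' : Fin 4 → ℝ) :
    Φ (fill i k v w w') = ∑ c, ∑ d, w c * w' d * Φ (fill i k v (eb c) (eb d)) := by
  have h1 : ∀ u, Φ (fill i k v u w') = ∑ d, w' d * Φ (fill i k v u (eb d)) := fun u =>
    update_expand Φ _ k w'
  have h2 : Φ (fill i k v w w') = ∑ c, w c * Φ (fill i k v (eb c) w') := by
    unfold fill
    simp only [Function.update_comm hik]
    exact update_expand Φ _ i w
  rw [h2]
  refine Finset.sum_congr rfl fun c _ => ?_
  rw [h1, Finset.mul_sum]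
  exact Finset.sum_congr rfl fun d _ => by ring

lemma lorentz_dual (L : Matrix (Fin 4) (Fin 4) ℝ) (hL : Lᵀ * ηM * L = ηM) :
    L * ηM * Lᵀ = ηM := by
  have h1 : (ηM * Lᵀ * ηM) * L = 1 := by
    rw [Matrix.mul_assoc, Matrix.mul_assoc, ← Matrix.mul_assoc Lᵀ, hL, etaM_sq]
  have h2 : L * (ηM * Lᵀ * ηM) = 1 := mul_eq_one_comm.1 h1
  calc L * ηM * Lᵀ = (L * (ηM * Lᵀ * ηM)) * ηM := by
        simp only [Matrix.mul_assoc, etaM_sq, Matrix.mul_one]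
    _ = ηM := by rw [h2, Matrix.one_mul]

lemma contr_inv {ι : Type} [DecidableEq ι] (i k : ι) (hik : i ≠ k) (Φ : MF ι) (hΦ : InvF Φ) :
    InvF (contr i k Φ) := by
  intro L hL hdet v
  set v' : Rest i k → (Fin 4 → ℝ) := fun x => L.mulVec (v x) with hv'
  have hfill : ∀ w, Φ (fill i k v' (L.mulVec w) (L.mulVec w)) = Φ (fill i k v w w) := by
    intro w
    rw [← hΦ L hL hdet (fill i k v w w)]
    congr 1
    funext x
    by_cases hk : x = k
    · subst hk; simp [fill]
    · by_cases hi : x = i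
      · subst hi; simp [fill, hk]
      · simp [fill, hi, hk, hv']
  have hd := lorentz_dual L hL
  have hent : ∀ c d, ∑ a, sg a * (L c a * L d a) = ηM c d := by
    intro c d
    rw [← hd]
    rw [Matrix.mul_apply]
    simp only [ηM, Matrix.mul_diagonal, Matrix.transpose_apply]
    exact Finset.sum_congr rfl fun a _ => by simp only [sg]; ring
  rw [contr_apply, contr_apply]
  symm
  calc ∑ a, sg a * Φ (fill i k v (eb a) (eb a))
      = ∑ a, sg a * ∑ c, ∑ d, L c a * L d a * Φ (fill i k v' (eb c) (eb d)) := by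
        refine Finset.sum_congr rfl fun a _ => ?_
        rw [← hfill, fill_expand i k hik]
        simp [eb]
    _ = ∑ c, ∑ d, (∑ a, sg a * (L c a * L d a)) * Φ (fill i k v' (eb c) (eb d)) := by
        simp only [Finset.mul_sum, Finset.sum_mul]
        rw [Finset.sum_comm]
        refine Finset.sum_congr rfl fun c _ => ?_
        rw [Finset.sum_comm]
        exact Finset.sum_congr rfl fun d _ => Finset.sum_congr rfl fun a _ => by ring
    _ = ∑ a, sg a * Φ (fill i k v' (eb a) (eb a)) := by
        refine Finset.sum_congr rfl fun c _ => ?_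
        simp only [hent, ηM, Matrix.diagonal_apply, ite_mul, zero_mul, Finset.sum_ite_eq,
          Finset.mem_univ, if_true]
        rfl

/-- Permuting slots. -/
abbrev Pm {ι : Type} (σ : Equiv.Perm ι) (Φ : MF ι) : MF ι := Φ.domDomCongr σ

lemma Pm_inv {ι : Type} (σ : Equiv.Perm ι) (Φ : MF ι) (h : InvF Φ) : InvF (Pm σ Φ) := by
  intro L hL hd v
  exact h L hL hd (fun x => v (σ x))

lemma casimir_mem {ι : Type} [Fintype ι] [DecidableEq ι] (Φ : MF ι) (hΦ : InvF Φ)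
    (IH : ∀ i k : ι, i ≠ k → ∀ Ψ : MF (Rest i k), InvF Ψ → Ψ ∈ W (Rest i k)) (i : ι) :
    (3:ℝ) • Φ + ∑ k ∈ Finset.univ.erase i, Pm (Equiv.swap i k) Φ ∈ W ι := by
  have h : (3:ℝ) • Φ + ∑ k ∈ Finset.univ.erase i, Pm (Equiv.swap i k) Φ =
      ∑ k ∈ Finset.univ.erase i, if hk : i ≠ k then mulLift i k hk (contr i k Φ) else 0 := by
    refine MultilinearMap.ext fun v => ?_
    have := casimir Φ hΦ i v
    simp only [_root_.add_apply, _root_.smul_apply, _root_.sum_apply,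
      MultilinearMap.domDomCongr_apply, smul_eq_mul]
    rw [this]
    refine Finset.sum_congr rfl fun k hk => ?_
    rw [dif_pos (Finset.ne_of_mem_erase hk).symm, mulLift_apply, contr_restrict]
  rw [h]
  refine Submodule.sum_mem _ fun k hk => ?_
  have hik := (Finset.ne_of_mem_erase hk).symm
  rw [dif_pos hik]
  exact mulLift_mem _ _ _ _ (IH i k hik _ (contr_inv i k (Finset.ne_of_mem_erase hk).symm Φ hΦ))

/-- Antisymmetry in the slots belonging to `S`. -/
def Anti {ι : Type} [DecidableEq ι] (y : MF ι) (S : Finset ι) : Prop :=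
  ∀ i ∈ S, ∀ j ∈ S, i ≠ j → ∀ v : ι → (Fin 4 → ℝ), y (fun x => v (Equiv.swap i j x)) = - y v

lemma anti_big {ι : Type} [Fintype ι] [DecidableEq ι] (y : MF ι) (S : Finset ι) (hy : Anti y S)
    (hS : 4 < S.card) : y = 0 := by
  refine Module.Basis.ext_multilinear (fun _ => Pi.basisFun ℝ (Fin 4)) fun f => ?_
  obtain ⟨i, hi, j, hj, hij, hf⟩ := Finset.exists_ne_map_eq_of_card_lt_of_maps_to
    (s := S) (t := (Finset.univ : Finset (Fin 4))) (by simpa using hS) (f := f)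
    (fun _ _ => Finset.mem_coe.2 (Finset.mem_univ _))
  have h := hy i hi j hj hij (fun x => Pi.basisFun ℝ (Fin 4) (f x))
  have h2 : (fun x => Pi.basisFun ℝ (Fin 4) (f (Equiv.swap i j x))) =
      fun x => Pi.basisFun ℝ (Fin 4) (f x) := by
    funext x
    by_cases hx : x = i
    · subst hx; simp [hf]
    · by_cases hx' : x = j
      · subst hx'; simp [hf]
      · rw [Equiv.swap_apply_of_ne_of_ne hx hx']
  rw [h2] at h
  simp only [_root_.zero_apply]
  linarith

lemma anti_det {ι : Type} [Fintype ι] [DecidableEq ι] (y : MF ι) (hy : Anti y Finset.univ)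
    (hc : Fintype.card ι = 4) : y ∈ W ι := by
  obtain ⟨e⟩ : Nonempty (Fin 4 ≃ ι) := ⟨(Fintype.equivFinOfCardEq hc).symm⟩
  let A : (Fin 4 → ℝ) [⋀^ι]→ₗ[ℝ] ℝ :=
    { y with
      map_eq_zero_of_eq' := by
        intro v i j hv hij
        have h := hy i (Finset.mem_univ _) j (Finset.mem_univ _) hij v
        have h2 : (fun x => v (Equiv.swap i j x)) = v := by
          funext x
          by_cases hx : x = i
          · subst hx; simp [hv]
          · by_cases hx' : x = j
            · subst hx'; simp [hv]
            · rw [Equiv.swap_apply_of_ne_of_ne hx hx']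
        rw [h2] at h
        change y v = 0
        linarith }
  let B := (Pi.basisFun ℝ (Fin 4)).reindex e
  have hA := A.eq_smul_basis_det B
  have h1 : y = A B • (B.det : (Fin 4 → ℝ) [⋀^ι]→ₗ[ℝ] ℝ).toMultilinearMap := by
    refine MultilinearMap.ext fun v => ?_
    exact congrArg (fun (F : (Fin 4 → ℝ) [⋀^ι]→ₗ[ℝ] ℝ) => F v) hA
  rw [h1]
  refine Submodule.smul_mem _ _ (Submodule.subset_span ⟨0, 1,
    ((Equiv.emptySum (Fin 0 × Fin 2) (Fin 1 × Fin 4)).trans (Equiv.uniqueProd (Fin 4) (Fin 1))).trans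
      e, ?_⟩)
  intro v
  simp only [Finset.univ_eq_empty, Finset.prod_empty, one_mul, Finset.univ_unique,
    Finset.prod_singleton]
  change B.det v = _
  rw [Module.Basis.det_apply, ← Matrix.det_submatrix_equiv_self e, ← Matrix.det_transpose]
  congr 1
  ext p q
  simp [B, Module.Basis.toMatrix_apply]

lemma swap_conj {ι : Type} [DecidableEq ι] (y : MF ι) (v : ι → (Fin 4 → ℝ)) (σ : Equiv.Perm ι)
    (a b : ι) :
    y (fun x => v (σ (Equiv.swap a b x))) = y (fun x => v (Equiv.swap (σ a) (σ b) (σ x))) := by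
  congr 1
  funext x
  have := congrArg (fun τ : Equiv.Perm ι => τ x) (Equiv.mul_swap_eq_swap_mul σ a b)
  exact congrArg v this

lemma anti_insert {ι : Type} [Fintype ι] [DecidableEq ι] (y : MF ι) (S : Finset ι)
    (hy : Anti y S) (j : ι) (hj : j ∉ S) :
    Anti (y - ∑ i ∈ S, Pm (Equiv.swap i j) y) (insert j S) := by
  have hz : ∀ v : ι → (Fin 4 → ℝ), (y - ∑ i ∈ S, Pm (Equiv.swap i j) y) v =
      y v - ∑ i ∈ S, y (fun x => v (Equiv.swap i j x)) := by
    intro v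
    simp only [_root_.sub_apply, _root_.sum_apply, MultilinearMap.domDomCongr_apply]
  have hA : ∀ p ∈ S, ∀ v : ι → (Fin 4 → ℝ), (y - ∑ i ∈ S, Pm (Equiv.swap i j) y)
      (fun x => v (Equiv.swap p j x)) = - (y - ∑ i ∈ S, Pm (Equiv.swap i j) y) v := by
    intro p hp v
    rw [hz, hz, ← Finset.add_sum_erase _ _ hp, ← Finset.add_sum_erase _ _ hp]
    have : ∀ i ∈ S.erase p, y (fun x => v (Equiv.swap p j (Equiv.swap i j x))) =
        - y (fun x => v (Equiv.swap i j x)) := by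
      intro i hi
      have hip := Finset.ne_of_mem_erase hi
      have hiS := Finset.mem_of_mem_erase hi
      have hij : i ≠ j := fun h => hj (h ▸ hiS)
      have hpj : p ≠ j := fun h => hj (h ▸ hp)
      rw [← hy i hiS p hp hip (fun x => v (Equiv.swap i j x))]
      have h := swap_conj y v (Equiv.swap i j) i p
      rw [Equiv.swap_apply_left, Equiv.swap_apply_of_ne_of_ne hip.symm hpj] at h
      rw [h, Equiv.swap_comm j p]
    rw [Finset.sum_congr rfl this, Finset.sum_neg_distrib]
    simp only [Equiv.swap_apply_self]
    ring
  intro p hp q hq hpq v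
  rcases Finset.mem_insert.1 hp with rfl | hp'
  · rcases Finset.mem_insert.1 hq with rfl | hq
    · exact absurd rfl hpq
    · rw [Equiv.swap_comm]; exact hA q hq v
  · rcases Finset.mem_insert.1 hq with rfl | hq
    · exact hA p hp' v
    · replace hp := hp'
      rw [hz, hz, hy p hp q hq hpq]
      have hpj : j ≠ p := fun h => hj (h ▸ hp)
      have hqj : j ≠ q := fun h => hj (h ▸ hq)
      have h1 : ∀ i ∈ S, y (fun x => v (Equiv.swap p q (Equiv.swap i j x))) =
          - y (fun x => v (Equiv.swap (Equiv.swap p q i) j x)) := by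
        intro i _
        rw [swap_conj y v (Equiv.swap p q) i j, Equiv.swap_apply_of_ne_of_ne hpj hqj]
        exact hy p hp q hq hpq (fun x => v (Equiv.swap (Equiv.swap p q i) j x))
      have h2 : ∑ i ∈ S, y (fun x => v (Equiv.swap (Equiv.swap p q i) j x)) =
          ∑ i ∈ S, y (fun x => v (Equiv.swap i j x)) := by
        refine Finset.sum_equiv (Equiv.swap p q) (fun i => ?_) (fun _ _ => rfl)
        by_cases h1 : i = p
        · subst h1; simp [hp, hq]
        · by_cases h2 : i = q
          · subst h2; simp [hp, hq]
          · rw [Equiv.swap_apply_of_ne_of_ne h1 h2]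
      rw [Finset.sum_congr rfl h1, Finset.sum_neg_distrib, h2]
      ring

lemma InvF.sub_sum {ι : Type} [DecidableEq ι] (y : MF ι) (hy : InvF y) (S : Finset ι) (j : ι) :
    InvF (y - ∑ i ∈ S, Pm (Equiv.swap i j) y) := by
  intro L hL hd v
  simp only [_root_.sub_apply, _root_.sum_apply]
  rw [hy L hL hd v]
  congr 1
  exact Finset.sum_congr rfl fun i _ => Pm_inv _ y hy L hL hd v

lemma step {ι : Type} [Fintype ι] [DecidableEq ι]
    (IH : ∀ i k : ι, i ≠ k → ∀ Ψ : MF (Rest i k), InvF Ψ → Ψ ∈ W (Rest i k)) (m : ℕ)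
    (hm : 1 ≤ m) (hm4 : m ≤ 4)
    (hC : ∀ (S : Finset ι), S.card = m + 1 → ∀ y : MF ι, InvF y → Anti y S → y ∈ W ι)
    (S : Finset ι) (hS : S.card = m) (y : MF ι) (hy : InvF y) (hA : Anti y S) : y ∈ W ι := by
  by_cases h4 : Sᶜ = ∅ ∧ m = 4
  · have hu : S = Finset.univ := by simpa using h4.1
    subst hu
    exact anti_det y hA (by rw [← h4.2, ← hS]; rfl)
  have h1 : ∑ j ∈ Sᶜ, (y - ∑ i ∈ S, Pm (Equiv.swap i j) y) ∈ W ι := by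
    refine Submodule.sum_mem _ fun j hj => ?_
    have hj' : j ∉ S := Finset.mem_compl.1 hj
    exact hC (insert j S) (by rw [Finset.card_insert_of_notMem hj', hS]) _
      (InvF.sub_sum y hy S j) (anti_insert y S hA j hj')
  have h2 : ∑ i ∈ S, ((3:ℝ) • y + ∑ k ∈ Finset.univ.erase i, Pm (Equiv.swap i k) y) ∈ W ι :=
    Submodule.sum_mem _ fun i _ => casimir_mem y hy IH i
  have h3 : ∀ i ∈ S, (3:ℝ) • y + ∑ k ∈ Finset.univ.erase i, Pm (Equiv.swap i k) y =
      (4 - m : ℝ) • y + ∑ j ∈ Sᶜ, Pm (Equiv.swap i j) y := by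
    intro i hi
    have hun : Finset.univ.erase i = S.erase i ∪ Sᶜ := by
      ext x
      simp only [Finset.mem_erase, Finset.mem_univ, Finset.mem_union, Finset.mem_compl]
      constructor
      · intro h; by_cases hx : x ∈ S
        · exact Or.inl ⟨h.1, hx⟩
        · exact Or.inr hx
      · rintro (h | h)
        · exact ⟨h.1, trivial⟩
        · exact ⟨fun h' => h (h' ▸ hi), trivial⟩
    have hdis : Disjoint (S.erase i) Sᶜ :=
      Finset.disjoint_of_subset_left (Finset.erase_subset _ _) disjoint_compl_right
    rw [hun, Finset.sum_union hdis]
    have : ∀ k ∈ S.erase i, Pm (Equiv.swap i k) y = (-1 : ℝ) • y := by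
      intro k hk
      refine MultilinearMap.ext fun v => ?_
      have := hA i hi k (Finset.mem_of_mem_erase hk) (Finset.ne_of_mem_erase hk).symm v
      simpa using this
    rw [Finset.sum_congr rfl this, Finset.sum_const, Finset.card_erase_of_mem hi, hS,
      ← Nat.cast_smul_eq_nsmul ℝ, Nat.cast_sub hm]
    module
  rw [Finset.sum_congr rfl h3, Finset.sum_add_distrib, Finset.sum_const, hS] at h2
  rw [Finset.sum_sub_distrib, Finset.sum_const, Finset.sum_comm] at h1
  have h5 := Submodule.add_mem _ h1 h2
  have h6 : (Sᶜ.card • y - ∑ i ∈ S, ∑ j ∈ Sᶜ, Pm (Equiv.swap i j) y +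
      (m • (4 - m : ℝ) • y + ∑ i ∈ S, ∑ j ∈ Sᶜ, Pm (Equiv.swap i j) y)) =
      ((Sᶜ.card : ℝ) + m * (4 - m)) • y := by
    rw [← Nat.cast_smul_eq_nsmul ℝ, ← Nat.cast_smul_eq_nsmul ℝ]
    module
  rw [h6] at h5
  refine (Submodule.smul_mem_iff _ ?_).1 h5
  have hm1 : (1:ℝ) ≤ m := by exact_mod_cast hm
  rcases lt_or_eq_of_le hm4 with h | h
  · have : (m:ℝ) < 4 := by exact_mod_cast h
    have : (0:ℝ) < m * (4 - m) := mul_pos (by linarith) (by linarith)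
    positivity
  · have : Sᶜ ≠ ∅ := fun h' => h4 ⟨h', h⟩
    have : 0 < Sᶜ.card := Finset.card_pos.2 (Finset.nonempty_iff_ne_empty.2 this)
    have : (0:ℝ) < Sᶜ.card := by exact_mod_cast this
    have h' : (m:ℝ) = 4 := by exact_mod_cast h
    rw [h']
    simp only [sub_self, mul_zero, add_zero]
    exact this.ne'

theorem main (N : ℕ) : ∀ (ι : Type) [Fintype ι], Fintype.card ι = N →
    ∀ Φ : MF ι, InvF Φ → Φ ∈ W ι := by
  induction N using Nat.strong_induction_on with
  | _ N ih =>
    intro ι _ hN Φ hΦ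
    classical
    rcases isEmpty_or_nonempty ι with hE | ⟨⟨i⟩⟩
    · let F : MF ι := MultilinearMap.constOfIsEmpty ℝ _ 1
      have : Φ = (Φ 0) • F := by
        refine MultilinearMap.ext fun v => ?_
        rw [Subsingleton.elim v 0]
        simp [F]
      rw [this]
      refine Submodule.smul_mem _ _ (Submodule.subset_span ⟨0, 0, Equiv.equivOfIsEmpty _ _, ?_⟩)
      intro v
      simp [F]
    · have IH : ∀ i k : ι, i ≠ k → ∀ Ψ : MF (Rest i k), InvF Ψ → Ψ ∈ W (Rest i k) := by
        intro i k _ Ψ hΨ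
        refine ih (Fintype.card (Rest i k)) ?_ _ rfl Ψ hΨ
        rw [← hN]
        exact Fintype.card_subtype_lt (x := i) (by simp)
      have c5 : ∀ (S : Finset ι), S.card = 5 → ∀ y : MF ι, InvF y → Anti y S → y ∈ W ι := by
        intro S hS y _ hA
        rw [anti_big y S hA (by omega)]
        exact Submodule.zero_mem _
      have c4 := step IH 4 (by norm_num) (by norm_num) c5
      have c3 := step IH 3 (by norm_num) (by norm_num) c4
      have c2 := step IH 2 (by norm_num) (by norm_num) c3
      have c1 := step IH 1 (by norm_num) (by norm_num) c2
      refine c1 {i} (by simp) Φ hΦ ?_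
      intro a ha b hb hab
      rw [Finset.mem_singleton] at ha hb
      exact absurd (ha.trans hb.symm) hab

end LorentzFFT

/-- **Classification of Lorentz-invariant multilinear forms.**
Every ℝ-multilinear form on n copies of ℝ⁴ invariant under the special Lorentz
group (Λᵀ η Λ = η, det Λ = 1) lies in the ℝ-linear span of the forms obtained by
partitioning the arguments into unordered pairs contracted with the Minkowski
metric and quadruples contracted with the Levi-Civita symbol (determinant). -/
theorem lorentz_invariant_forms (n : ℕ) (hn : 1 ≤ n)
    (Φ : MultilinearMap ℝ (fun _ : Fin n => (Fin 4 → ℝ)) ℝ)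
    (hinv : ∀ L : Matrix (Fin 4) (Fin 4) ℝ, Lᵀ * ηM * L = ηM → L.det = 1 →
      ∀ v : Fin n → (Fin 4 → ℝ), Φ (fun k => L.mulVec (v k)) = Φ v) :
    Φ ∈ Submodule.span ℝ
      { F : MultilinearMap ℝ (fun _ : Fin n => (Fin 4 → ℝ)) ℝ |
        ∃ (a b : ℕ) (e : (Fin a × Fin 2) ⊕ (Fin b × Fin 4) ≃ Fin n),
          ∀ v : Fin n → (Fin 4 → ℝ),
            F v = (∏ i : Fin a, minkDot (v (e (Sum.inl (i, 0)))) (v (e (Sum.inl (i, 1)))))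
              * ∏ j : Fin b,
                  Matrix.det (Matrix.of fun p q : Fin 4 => v (e (Sum.inr (j, p))) q) } := by
  exact LorentzFFT.main n (Fin n) (by simp) Φ hinv
end
end

section
/- Under the su(N) generator hypotheses, the Dirac matrices in the Dirac representation, and the Grassmann setup, the scalar Fierz identity for U(N) fermions holds: Σ_{a : Fin (N^2−1)} ⟪1, T a⟫ * ⟪1, T a⟫ = −((N+4)/(8·N)) • ⟪1⟫ * ⟪1⟫ − (1/8) • Σ_{μ} ε μ • ⟪γ μ⟫ * ⟪γ μ⟫ − (1/16) • Σ_{μ,ν} ε μ · ε ν • ⟪σ μ ν⟫ * ⟪σ μ ν⟫ + (1/8) • Σ_{μ} ε μ • ⟪γ5 * γ μ⟫ * ⟪γ5 * γ μ⟫ − (1/8) • ⟪γ5⟫ * ⟪γ5⟫, where μ, ν range over Fin 4. -/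
noncomputable section

open Complex Matrix

/-- The Dirac γ-matrices in the Dirac representation. -/
def γm : Fin 4 → Matrix (Fin 4) (Fin 4) ℂ :=
  ![!![1,0,0,0; 0,1,0,0; 0,0,-1,0; 0,0,0,-1],
    !![0,0,0,1; 0,0,1,0; 0,-1,0,0; -1,0,0,0],
    !![0,0,0,-I; 0,0,I,0; 0,I,0,0; -I,0,0,0],
    !![0,0,1,0; 0,0,0,-1; -1,0,0,0; 0,1,0,0]]

/-- γ⁵ = i·γ⁰γ¹γ²γ³. -/
def γ5 : Matrix (Fin 4) (Fin 4) ℂ := I • (γm 0 * γm 1 * γm 2 * γm 3)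

/-- σ^{μν} = (i/2)[γ^μ, γ^ν]. -/
def σm (μ ν : Fin 4) : Matrix (Fin 4) (Fin 4) ℂ := (I / 2) • (γm μ * γm ν - γm ν * γm μ)

/-- The metric signs ε 0 = 1, ε 1 = ε 2 = ε 3 = −1 used to raise/lower indices. -/
def εs : Fin 4 → ℤ := ![1, -1, -1, -1]

/-- The totally antisymmetric Levi-Civita symbol on four indices,
normalized by ε₄ 0 1 2 3 = 1. -/
def ε4 (κ l μ ν : Fin 4) : ℤ :=
  Matrix.det (Matrix.of fun p q : Fin 4 => if ![κ, l, μ, ν] p = q then (1 : ℤ) else 0)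

/-- The Grassmann algebra generated by the 8N fermion components:
the exterior algebra of the direct sum of two copies of (Fin 4 × Fin N) → ℂ. -/
abbrev GrassAlg (N : ℕ) :=
  ExteriorAlgebra ℂ (((Fin 4 × Fin N) → ℂ) × ((Fin 4 × Fin N) → ℂ))

/-- ψ (A, i): the image in the Grassmann algebra of the standard basis vector
of the first summand indexed by (A, i). -/
def ψv (N : ℕ) (A : Fin 4) (i : Fin N) : GrassAlg N :=
  ExteriorAlgebra.ι ℂ (Pi.single (A, i) 1, 0)

/-- ψ̄ (A, i): the image in the Grassmann algebra of the standard basis vector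
of the second summand indexed by (A, i). -/
def ψbar (N : ℕ) (A : Fin 4) (i : Fin N) : GrassAlg N :=
  ExteriorAlgebra.ι ℂ (0, Pi.single (A, i) 1)

/-- The fermion bilinear B Γ i j = ∑_{A,B} Γ A B · ψ̄ (A,i) ψ (B,j). -/
def Bgr (N : ℕ) (Γ : Matrix (Fin 4) (Fin 4) ℂ) (i j : Fin N) : GrassAlg N :=
  ∑ A : Fin 4, ∑ B : Fin 4, Γ A B • (ψbar N A i * ψv N B j)

/-- ⟪Γ, X⟫ = ∑_{i,j} X i j · B Γ i j, the bilinear with Dirac structure Γ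
and color structure X. -/
def pairing (N : ℕ) (Γ : Matrix (Fin 4) (Fin 4) ℂ)
    (X : Matrix (Fin N) (Fin N) ℂ) : GrassAlg N :=
  ∑ i : Fin N, ∑ j : Fin N, X i j • Bgr N Γ i j

/-- ⟪Γ⟫ = ⟪Γ, 1⟫, the color-singlet bilinear. -/
def sing (N : ℕ) (Γ : Matrix (Fin 4) (Fin 4) ℂ) : GrassAlg N := pairing N Γ 1

theorem γ5_explicit : γ5 = !![0,0,1,0; 0,0,0,1; 1,0,0,0; 0,1,0,0] := by
  ext i j
  fin_cases i <;> fin_cases j <;>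
    simp [γ5, γm]

theorem γ5γ_explicit : (fun μ => γ5 * γm μ) =
    ![!![0,0,-1,0; 0,0,0,-1; 1,0,0,0; 0,1,0,0],
      !![0,-1,0,0; -1,0,0,0; 0,0,0,1; 0,0,1,0],
      !![0,I,0,0; -I,0,0,0; 0,0,0,-I; 0,0,I,0],
      !![-1,0,0,0; 0,1,0,0; 0,0,1,0; 0,0,0,-1]] := by
  ext μ i j
  rw [γ5_explicit]
  fin_cases μ <;> fin_cases i <;> fin_cases j <;>
    simp [γm, Matrix.mul_apply, Fin.sum_univ_four]

theorem σm_self (μ : Fin 4) : σm μ μ = 0 := by simp [σm]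

theorem σm_swap (μ ν : Fin 4) : σm μ ν = - σm ν μ := by
  simp only [σm, ← smul_neg, neg_sub]

theorem σm01 : σm 0 1 = !![0,0,0,I; 0,0,I,0; 0,I,0,0; I,0,0,0] := by
  ext i j
  fin_cases i <;> fin_cases j <;>
    simp [σm, γm] <;> ring

theorem σm02 : σm 0 2 = !![0,0,0,1; 0,0,-1,0; 0,1,0,0; -1,0,0,0] := by
  ext i j
  fin_cases i <;> fin_cases j <;>
    simp [σm, γm] <;> ring_nf <;> simp

theorem σm03 : σm 0 3 = !![0,0,I,0; 0,0,0,-I; I,0,0,0; 0,-I,0,0] := by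
  ext i j
  fin_cases i <;> fin_cases j <;>
    simp [σm, γm] <;> ring

theorem σm12 : σm 1 2 = !![1,0,0,0; 0,-1,0,0; 0,0,1,0; 0,0,0,-1] := by
  ext i j
  fin_cases i <;> fin_cases j <;>
    simp [σm, γm] <;> ring_nf <;> simp

theorem σm13 : σm 1 3 = !![0,I,0,0; -I,0,0,0; 0,0,0,I; 0,0,-I,0] := by
  ext i j
  fin_cases i <;> fin_cases j <;>
    simp [σm, γm] <;> ring

theorem σm23 : σm 2 3 = !![0,1,0,0; 1,0,0,0; 0,0,0,1; 0,0,1,0] := by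
  ext i j
  fin_cases i <;> fin_cases j <;>
    simp [σm, γm] <;> ring_nf <;> simp

/-- The tensor part of the Dirac completeness relation. -/
theorem σ_sum (A B C D : Fin 4) :
    ∑ μ, ∑ ν, ((εs μ : ℂ) * (εs ν : ℂ)) * (σm μ ν A B * σm μ ν C D) =
      2 * (σm 1 2 A B * σm 1 2 C D + σm 1 3 A B * σm 1 3 C D + σm 2 3 A B * σm 2 3 C D
        - σm 0 1 A B * σm 0 1 C D - σm 0 2 A B * σm 0 2 C D - σm 0 3 A B * σm 0 3 C D) := by
  simp only [Fin.sum_univ_four, σm_self, σm_swap 1 0, σm_swap 2 0, σm_swap 3 0, σm_swap 2 1,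
    σm_swap 3 1, σm_swap 3 2, Matrix.neg_apply, Matrix.zero_apply]
  simp [εs]
  ring

set_option maxHeartbeats 4000000 in
theorem dirac_complete (A B C D : Fin 4) :
    (1 : Matrix (Fin 4) (Fin 4) ℂ) A B * (1 : Matrix (Fin 4) (Fin 4) ℂ) C D
      + ∑ μ, (εs μ : ℂ) * (γm μ A B * γm μ C D)
      + (1 / 2) * ∑ μ, ∑ ν, ((εs μ : ℂ) * (εs ν : ℂ)) * (σm μ ν A B * σm μ ν C D)
      - ∑ μ, (εs μ : ℂ) * ((γ5 * γm μ) A B * (γ5 * γm μ) C D)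
      + γ5 A B * γ5 C D
    = 4 * (if A = D ∧ B = C then 1 else 0) := by
  have h : ∀ μ, γ5 * γm μ = _ := fun μ => congrFun γ5γ_explicit μ
  rw [σ_sum]
  simp only [h]
  rw [γ5_explicit, σm01, σm02, σm03, σm12, σm13, σm23]
  simp only [Fin.sum_univ_four]
  fin_cases A <;> fin_cases B <;> fin_cases C <;> fin_cases D <;>
    simp [γm, εs] <;> norm_num

/-- Colour completeness. -/
theorem color_complete (N : ℕ) (hN : 2 ≤ N)
    (T : Fin (N ^ 2 - 1) → Matrix (Fin N) (Fin N) ℂ)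
    (htr : ∀ a, (T a).trace = 0)
    (horth : ∀ a b, (T a * T b).trace = if a = b then (1 / 2 : ℂ) else 0) (i j k l : Fin N) :
    ∑ a, T a i j * T a k l = (1 / 2) * (if j = k ∧ i = l then 1 else 0)
      - (1 / (2 * (N : ℂ))) * ((1 : Matrix (Fin N) (Fin N) ℂ) i j *
          (1 : Matrix (Fin N) (Fin N) ℂ) k l) := by
  have hN0 : (N : ℂ) ≠ 0 := by
    have : N ≠ 0 := by omega
    exact_mod_cast this
  let M : Matrix (Option (Fin (N ^ 2 - 1))) (Fin N × Fin N) ℂ := Matrix.of fun o p =>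
    match o with
    | none => (1 : Matrix (Fin N) (Fin N) ℂ) p.1 p.2 / N
    | some a => 2 * T a p.1 p.2
  let M' : Matrix (Fin N × Fin N) (Option (Fin (N ^ 2 - 1))) ℂ := Matrix.of fun p o =>
    match o with
    | none => (1 : Matrix (Fin N) (Fin N) ℂ) p.2 p.1
    | some a => T a p.2 p.1
  have h1 : M * M' = 1 := by
    ext o o'
    rcases o with _ | a <;> rcases o' with _ | b
    · simp [M, M', Matrix.mul_apply, Fintype.sum_prod_type, Matrix.one_apply, hN0]
    · have := htr b
      simp only [Matrix.trace, Matrix.diag] at this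
      simp [M, M', Matrix.mul_apply, Fintype.sum_prod_type, Matrix.one_apply, div_mul_eq_mul_div,
        ← Finset.sum_div, this]
    · have := htr a
      simp only [Matrix.trace, Matrix.diag] at this
      simp [M, M', Matrix.mul_apply, Fintype.sum_prod_type, Matrix.one_apply, ← Finset.mul_sum,
        this]
    · have := horth a b
      simp only [Matrix.trace, Matrix.diag, Matrix.mul_apply] at this
      simp only [M, M', Matrix.mul_apply, Fintype.sum_prod_type, Matrix.of_apply, mul_assoc,
        ← Finset.mul_sum, this, Matrix.one_apply]
      by_cases hab : a = b <;> simp [hab]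
  have hc : Fintype.card (Option (Fin (N ^ 2 - 1))) = Fintype.card (Fin N × Fin N) := by
    have : 0 < N ^ 2 := by positivity
    simp [← pow_two]
    omega
  have h2 : M' * M = 1 := (Matrix.mul_eq_one_comm_of_card_eq _ _ _ hc).1 h1
  have h3 := congrFun (congrFun h2 (j, i)) (k, l)
  simp only [M, M', Matrix.mul_apply, Fintype.sum_option, Matrix.of_apply, Matrix.one_apply,
    Prod.mk.injEq] at h3
  simp only [Matrix.one_apply]
  have h4 : ∑ a, T a i j * (2 * T a k l) = 2 * ∑ a, T a i j * T a k l := by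
    rw [Finset.mul_sum]
    exact Finset.sum_congr rfl fun a _ => by ring
  rw [h4] at h3
  rw [← h3]
  field_simp
  ring

/-- The colour-singlet elementary bilinear. -/
def sbil (N : ℕ) (A B : Fin 4) : GrassAlg N := ∑ i, ψbar N A i * ψv N B i

theorem sing_eq (N : ℕ) (Γ : Matrix (Fin 4) (Fin 4) ℂ) :
    sing N Γ = ∑ A, ∑ B, Γ A B • sbil N A B := by
  simp only [sing, pairing, Bgr, sbil, Matrix.one_apply, ite_smul, one_smul, zero_smul,
    Finset.sum_ite_eq, Finset.mem_univ, if_true]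
  simp only [Finset.smul_sum]
  rw [Finset.sum_comm]
  exact Finset.sum_congr rfl fun A _ => Finset.sum_comm

theorem sing_mul (N : ℕ) (Γ : Matrix (Fin 4) (Fin 4) ℂ) :
    sing N Γ * sing N Γ =
      ∑ A, ∑ B, ∑ C, ∑ D, (Γ A B * Γ C D) • (sbil N A B * sbil N C D) := by
  simp only [sing_eq, Finset.sum_mul]
  simp only [Finset.mul_sum, smul_mul_smul_comm]

theorem ι_anti {N : ℕ} (x y : ((Fin 4 × Fin N) → ℂ) × ((Fin 4 × Fin N) → ℂ)) :
    ExteriorAlgebra.ι ℂ x * ExteriorAlgebra.ι ℂ y =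
      -(ExteriorAlgebra.ι ℂ y * ExteriorAlgebra.ι ℂ x) :=
  eq_neg_of_add_eq_zero_left (ExteriorAlgebra.ι_add_mul_swap x y)

/-- Grassmann reordering. -/
theorem reorder (N : ℕ) (A C : Fin 4) (i j : Fin N) :
    (ψbar N A i * ψv N A j) * (ψbar N C j * ψv N C i) =
      -((ψbar N A i * ψv N C i) * (ψbar N C j * ψv N A j)) := by
  have h1 : ψbar N C j * ψv N C i = -(ψv N C i * ψbar N C j) := ι_anti _ _
  have h2 : ψv N A j * ψv N C i = -(ψv N C i * ψv N A j) := ι_anti _ _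
  have h3 : ψv N A j * ψbar N C j = -(ψbar N C j * ψv N A j) := ι_anti _ _
  calc (ψbar N A i * ψv N A j) * (ψbar N C j * ψv N C i)
      = -(ψbar N A i * (ψv N A j * ψv N C i) * ψbar N C j) := by rw [h1]; noncomm_ring
    _ = ψbar N A i * ψv N C i * (ψv N A j * ψbar N C j) := by rw [h2]; noncomm_ring
    _ = _ := by rw [h3]; noncomm_ring

theorem B_swap_sum (N : ℕ) :
    ∑ i, ∑ j, Bgr N 1 i j * Bgr N 1 j i = - ∑ A, ∑ C, sbil N A C * sbil N C A := by
  have hB : ∀ i j, Bgr N 1 i j = ∑ A, ψbar N A i * ψv N A j := by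
    intro i j
    simp [Bgr, Matrix.one_apply]
  simp only [hB, sbil, Finset.sum_mul_sum, reorder, Finset.sum_neg_distrib]
  congr 1
  calc _ = ∑ i, ∑ A, ∑ j, ∑ C, ψbar N A i * ψv N C i * (ψbar N C j * ψv N A j) :=
        Finset.sum_congr rfl fun i _ => Finset.sum_comm
    _ = ∑ A, ∑ i, ∑ j, ∑ C, ψbar N A i * ψv N C i * (ψbar N C j * ψv N A j) := Finset.sum_comm
    _ = ∑ A, ∑ i, ∑ C, ∑ j, ψbar N A i * ψv N C i * (ψbar N C j * ψv N A j) :=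
        Finset.sum_congr rfl fun A _ => Finset.sum_congr rfl fun i _ => Finset.sum_comm
    _ = _ := Finset.sum_congr rfl fun A _ => Finset.sum_comm

theorem lhs_eq (N : ℕ) (hN : 2 ≤ N)
    (T : Fin (N ^ 2 - 1) → Matrix (Fin N) (Fin N) ℂ)
    (htr : ∀ a, (T a).trace = 0)
    (horth : ∀ a b, (T a * T b).trace = if a = b then (1 / 2 : ℂ) else 0) :
    ∑ a, pairing N 1 (T a) * pairing N 1 (T a) =
      (1 / 2 : ℂ) • (∑ i, ∑ j, Bgr N 1 i j * Bgr N 1 j i)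
        - (1 / (2 * (N : ℂ))) • (sing N 1 * sing N 1) := by
  have hm : ∀ X, pairing N 1 X * pairing N 1 X = ∑ i, ∑ j, ∑ k, ∑ l,
      (X i j * X k l) • (Bgr N 1 i j * Bgr N 1 k l) := by
    intro X
    simp only [pairing, Finset.sum_mul]
    simp only [Finset.mul_sum, smul_mul_smul_comm]
  have h1 : ∑ a, pairing N 1 (T a) * pairing N 1 (T a) = ∑ i, ∑ j, ∑ k, ∑ l,
      (∑ a, T a i j * T a k l) • (Bgr N 1 i j * Bgr N 1 k l) := by
    simp only [hm, Finset.sum_smul]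
    rw [Finset.sum_comm]
    refine Finset.sum_congr rfl fun i _ => ?_
    rw [Finset.sum_comm]
    refine Finset.sum_congr rfl fun j _ => ?_
    rw [Finset.sum_comm]
    refine Finset.sum_congr rfl fun k _ => ?_
    rw [Finset.sum_comm]
  rw [h1]
  simp only [color_complete N hN T htr horth, sub_smul, Finset.sum_sub_distrib]
  congr 1
  · simp only [mul_smul, ← Finset.smul_sum]
    congr 1
    refine Finset.sum_congr rfl fun i _ => Finset.sum_congr rfl fun j _ => ?_
    simp only [ite_and, ite_smul, one_smul, zero_smul]
    simp
  · rw [sing, hm]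
    simp only [mul_smul _ (_ * _), ← Finset.smul_sum]

theorem rhs_eq (N : ℕ) :
    sing N 1 * sing N 1 + ∑ μ, (εs μ : ℂ) • (sing N (γm μ) * sing N (γm μ))
      + (1 / 2 : ℂ) • ∑ μ, ∑ ν, ((εs μ : ℂ) * (εs ν : ℂ)) •
            (sing N (σm μ ν) * sing N (σm μ ν))
      - ∑ μ, (εs μ : ℂ) • (sing N (γ5 * γm μ) * sing N (γ5 * γm μ))
      + sing N γ5 * sing N γ5
    = (4 : ℂ) • ∑ A, ∑ C, sbil N A C * sbil N C A := by
  have key : (4 : ℂ) • ∑ A, ∑ C, sbil N A C * sbil N C A = ∑ A, ∑ B, ∑ C, ∑ D,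
      ((4 : ℂ) * (if A = D ∧ B = C then 1 else 0)) • (sbil N A B * sbil N C D) := by
    simp only [mul_smul, ← Finset.smul_sum]
    congr 1
    refine Finset.sum_congr rfl fun A _ => Finset.sum_congr rfl fun B _ => ?_
    rw [Finset.sum_eq_single B, Finset.sum_eq_single A]
    · simp
    · intro D _ h
      simp [h.symm]
    · simp
    · intro C _ h
      simp [h.symm]
    · simp
  have pull1 : ∀ G : Fin 4 → Matrix (Fin 4) (Fin 4) ℂ, ∀ c : Fin 4 → ℂ,
      ∑ μ, c μ • (sing N (G μ) * sing N (G μ)) = ∑ A, ∑ B, ∑ C, ∑ D,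
        (∑ μ, c μ * (G μ A B * G μ C D)) • (sbil N A B * sbil N C D) := by
    intro G c
    simp only [sing_mul, Finset.smul_sum, smul_smul, Finset.sum_smul]
    rw [Finset.sum_comm]
    refine Finset.sum_congr rfl fun i _ => ?_
    rw [Finset.sum_comm]
    refine Finset.sum_congr rfl fun j _ => ?_
    rw [Finset.sum_comm]
    refine Finset.sum_congr rfl fun k _ => ?_
    rw [Finset.sum_comm]
  have pull2 : ∑ μ, ∑ ν, ((εs μ : ℂ) * (εs ν : ℂ)) • (sing N (σm μ ν) * sing N (σm μ ν)) =
      ∑ A, ∑ B, ∑ C, ∑ D, (∑ μ, ∑ ν, ((εs μ : ℂ) * (εs ν : ℂ)) *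
        (σm μ ν A B * σm μ ν C D)) • (sbil N A B * sbil N C D) := by
    simp only [fun μ => pull1 (σm μ) (fun ν => (εs μ : ℂ) * (εs ν : ℂ)),
      Finset.sum_smul (s := Finset.univ) (f := fun μ => ∑ ν, ((εs μ : ℂ) * (εs ν : ℂ)) * _)]
    rw [Finset.sum_comm]
    refine Finset.sum_congr rfl fun i _ => ?_
    rw [Finset.sum_comm]
    refine Finset.sum_congr rfl fun j _ => ?_
    rw [Finset.sum_comm]
    refine Finset.sum_congr rfl fun k _ => ?_
    rw [Finset.sum_comm]
  rw [key, pull2, pull1 γm, pull1 (fun μ => γ5 * γm μ), sing_mul, sing_mul]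
  simp only [Finset.smul_sum, smul_smul, ← Finset.sum_add_distrib, ← Finset.sum_sub_distrib,
    ← add_smul, ← sub_smul, dirac_complete]

/-- **Scalar Fierz identity for U(N) fermions.** -/
theorem fierz_scalar (N : ℕ) (hN : 2 ≤ N)
    (T : Fin (N ^ 2 - 1) → Matrix (Fin N) (Fin N) ℂ)
    (htr : ∀ a, (T a).trace = 0)
    (hherm : ∀ a, (T a)ᴴ = T a)
    (horth : ∀ a b, (T a * T b).trace = if a = b then (1 / 2 : ℂ) else 0) :
    ∑ a, pairing N 1 (T a) * pairing N 1 (T a) =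
      (-(((N : ℂ) + 4) / (8 * (N : ℂ)))) • (sing N 1 * sing N 1)
        - (1 / 8 : ℂ) • ∑ μ, (εs μ : ℂ) • (sing N (γm μ) * sing N (γm μ))
        - (1 / 16 : ℂ) • ∑ μ, ∑ ν, ((εs μ : ℂ) * (εs ν : ℂ)) •
            (sing N (σm μ ν) * sing N (σm μ ν))
        + (1 / 8 : ℂ) • ∑ μ, (εs μ : ℂ) • (sing N (γ5 * γm μ) * sing N (γ5 * γm μ))
        - (1 / 8 : ℂ) • (sing N γ5 * sing N γ5) := by
  have hN0 : (N : ℂ) ≠ 0 := by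
    have : N ≠ 0 := by omega
    exact_mod_cast this
  rw [lhs_eq N hN T htr horth, B_swap_sum]
  have h := rhs_eq N
  have hc : (((N : ℂ) + 4) / (8 * (N : ℂ))) = 1 / 8 + 1 / (2 * (N : ℂ)) := by
    field_simp
    ring
  rw [hc]
  have h2 : ∑ A, ∑ C, sbil N A C * sbil N C A = (1 / 4 : ℂ) • ((4 : ℂ) •
      ∑ A, ∑ C, sbil N A C * sbil N C A) := by
    rw [smul_smul]; norm_num
  rw [h2, ← h]
  module
end
end
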